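/- Let R = R_{n,e,P,Q}. Then the invariants AL_i(R) are given by: (1) AL_0(R) = k[x] = ML(R) (so the Derksen invariant of R equals k[x]); (2) AL_i(R) = k[x,s] for all 1 ≤ i ≤ d−1; (3) AL_i(R) = k[x,s,y] for all d ≤ i ≤ md−1, and this subalgebra is isomorphic to the Danielewski domain B_{n,P} = k[X,S,Y]/⟨X^nY − P(X,S)⟩; (4) AL_{md}(R) = R. -/

import Mathlib

open MvPolynomial

/-- A locally nilpotent `k`-derivation. -/
def IsLND {k B : Type*} [CommRing k] [CommRing B] [Algebra k B]
    (D : Derivation k B B) : Prop :=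
  ∀ a : B, ∃ n : ℕ, ((D.toLinearMap : Module.End k B) ^ n) a = 0

noncomputable section

variable (k : Type*) [Field k] [CharZero k]

/-- `P(X,T) = T^d + f_{d-1}(X) T^{d-1} + ⋯ + f_0(X)` evaluated at `T`, inside `k[X,Y,Z]`
(the variable `X` has index 0). -/
def Pat (d : ℕ) (f : ℕ → Polynomial k) (T : MvPolynomial (Fin 3) k) :
    MvPolynomial (Fin 3) k :=
  T ^ d + ∑ i ∈ Finset.range d, Polynomial.aeval (X 0) (f i) * T ^ i

/-- `Q(X,Y) = Y^m + g_{m-1}(X) Y^{m-1} + ⋯ + g_0(X)` in `k[X,Y,Z]`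
(variables `X = 0`, `Y = 1`, `Z = 2`). -/
def Qpoly (m : ℕ) (g : ℕ → Polynomial k) : MvPolynomial (Fin 3) k :=
  X 1 ^ m + ∑ j ∈ Finset.range m, Polynomial.aeval (X 0) (g j) * X 1 ^ j

/-- The ideal `⟨XⁿY - P(X, Q(X,Y) - XᵉZ)⟩` of `k[X,Y,Z]` (variables `X = 0`, `Y = 1`, `Z = 2`). -/
def RIdeal (n e d m : ℕ) (f g : ℕ → Polynomial k) : Ideal (MvPolynomial (Fin 3) k) :=
  Ideal.span {X 0 ^ n * X 1 - Pat k d f (Qpoly k m g - X 0 ^ e * X 2)}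

/-- `R_{n,e,P,Q} = k[X,Y,Z]/⟨XⁿY - P(X, Q(X,Y) - XᵉZ)⟩`. -/
def RRing (n e d m : ℕ) (f g : ℕ → Polynomial k) : Type _ :=
  MvPolynomial (Fin 3) k ⧸ RIdeal k n e d m f g

instance (n e d m : ℕ) (f g : ℕ → Polynomial k) : CommRing (RRing k n e d m f g) :=
  Ideal.Quotient.commRing _

instance (n e d m : ℕ) (f g : ℕ → Polynomial k) : Algebra k (RRing k n e d m f g) :=
  Ideal.Quotient.algebra k

variable (n e d m : ℕ) (f g : ℕ → Polynomial k)

/-- The class `x` of `X` in `R_{n,e,P,Q}`. -/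
def xel : RRing k n e d m f g := Ideal.Quotient.mk _ (X 0)

/-- The class `y` of `Y` in `R_{n,e,P,Q}`. -/
def yel : RRing k n e d m f g := Ideal.Quotient.mk _ (X 1)

/-- The class `z` of `Z` in `R_{n,e,P,Q}`. -/
def zel : RRing k n e d m f g := Ideal.Quotient.mk _ (X 2)

/-- The element `s = Q(x,y) - xᵉz` of `R_{n,e,P,Q}`. -/
def sel : RRing k n e d m f g := Ideal.Quotient.mk _ (Qpoly k m g - X 0 ^ e * X 2)

/-- `(∂P/∂S)(x,s)` in `R_{n,e,P,Q}`. -/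
def PSel : RRing k n e d m f g :=
  (d : RRing k n e d m f g) * sel k n e d m f g ^ (d - 1) +
    ∑ i ∈ Finset.range d, (i : RRing k n e d m f g) *
      Polynomial.aeval (xel k n e d m f g) (f i) * sel k n e d m f g ^ (i - 1)

/-- `(∂Q/∂Y)(x,y)` in `R_{n,e,P,Q}`. -/
def QYel : RRing k n e d m f g :=
  (m : RRing k n e d m f g) * yel k n e d m f g ^ (m - 1) +
    ∑ j ∈ Finset.range m, (j : RRing k n e d m f g) *
      Polynomial.aeval (xel k n e d m f g) (g j) * yel k n e d m f g ^ (j - 1)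

end

/-- Makar-Limanov invariant. -/
def ML (k B : Type*) [CommRing k] [CommRing B] [Algebra k B] : Set B :=
  {b : B | ∀ D : Derivation k B B, IsLND D → D b = 0}

/-- The `AL_i`-invariant: the `k`-subalgebra of `B` generated by `ker ∂^{i+1}` for all
nonzero locally nilpotent derivations `∂` of `B`. -/
def ALi (k B : Type*) [CommRing k] [CommRing B] [Algebra k B] (i : ℕ) : Subalgebra k B :=
  Algebra.adjoin k {b : B | ∃ D : Derivation k B B, IsLND D ∧ D ≠ 0 ∧
    ((D.toLinearMap : Module.End k B) ^ (i + 1)) b = 0}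

noncomputable section

variable (k : Type*) [Field k] [CharZero k]

/-- The ideal `⟨XⁿY - P(X,S)⟩` of `k[X,S,Y]` (variables `X = 0`, `S = 1`, `Y = 2`). -/
def DanIdeal (n d : ℕ) (f : ℕ → Polynomial k) : Ideal (MvPolynomial (Fin 3) k) :=
  Ideal.span {X 0 ^ n * X 2 - Pat k d f (X 1)}

/-- The Danielewski domain `B_{n,P} = k[X,S,Y]/⟨XⁿY - P(X,S)⟩`. -/
def DanRing (n d : ℕ) (f : ℕ → Polynomial k) : Type _ :=
  MvPolynomial (Fin 3) k ⧸ DanIdeal k n d f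

instance (n d : ℕ) (f : ℕ → Polynomial k) : CommRing (DanRing k n d f) :=
  Ideal.Quotient.commRing _

instance (n d : ℕ) (f : ℕ → Polynomial k) : Algebra k (DanRing k n d f) :=
  Ideal.Quotient.algebra k

end

section Euler

variable {k G : Type*} [CommRing k] [AddCommGroup G]

/-- The linear endomorphism of a group algebra multiplying the monomial of exponent `v` by `χ v`. -/
noncomputable def eulerMap (χ : G →+ k) :
    AddMonoidAlgebra k G →ₗ[k] AddMonoidAlgebra k G where
  toFun F := AddMonoidAlgebra.ofCoeff
    (Finsupp.onFinset F.coeff.support (fun v => χ v * F.coeff v)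
      (fun v hv => by simpa using right_ne_zero_of_mul hv))
  map_add' F H := by ext v; simp [mul_add]
  map_smul' a F := by ext v; simp [mul_left_comm]

theorem eulerMap_coeff (χ : G →+ k) (F : AddMonoidAlgebra k G) (v : G) :
    (eulerMap χ F).coeff v = χ v * F.coeff v := rfl

theorem eulerMap_single (χ : G →+ k) (v : G) (a : k) :
    eulerMap χ (AddMonoidAlgebra.single v a) = AddMonoidAlgebra.single v (χ v * a) := by
  classical
  ext u
  by_cases h : v = u <;> simp [eulerMap_coeff, h]

/-- The derivation of a group algebra multiplying the monomial of exponent `v` by `χ v`. -/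
noncomputable def eulerDer (χ : G →+ k) :
    Derivation k (AddMonoidAlgebra k G) (AddMonoidAlgebra k G) :=
  Derivation.mk' (eulerMap χ) fun F H => by
    induction F using AddMonoidAlgebra.induction_linear with
    | zero => simp
    | add F F' h h' =>
      rw [add_mul, map_add, h, h', map_add]
      simp only [smul_eq_mul]
      ring
    | single v a =>
      induction H using AddMonoidAlgebra.induction_linear with
      | zero => simp
      | add F F' h h' =>
        rw [mul_add, map_add, h, h', map_add]
        simp only [smul_eq_mul]
        ring
      | single w b =>
        simp only [AddMonoidAlgebra.single_mul_single, eulerMap_single, smul_eq_mul, map_add]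
        rw [add_comm w v, ← AddMonoidAlgebra.single_add]
        congr 1
        ring

theorem eulerDer_coeff (χ : G →+ k) (F : AddMonoidAlgebra k G) (v : G) :
    (eulerDer χ F).coeff v = χ v * F.coeff v := rfl

theorem eulerDer_single (χ : G →+ k) (v : G) (a : k) :
    eulerDer χ (AddMonoidAlgebra.single v a) = AddMonoidAlgebra.single v (χ v * a) :=
  eulerMap_single χ v a

end Euler

section Leading

variable {k G : Type*} [CommRing k] [LinearOrder G]

/-- All exponents of `F` are at most `v`, and the coefficient of `F` at `v` is `c`
(which is allowed to vanish). -/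
def IsLead (F : AddMonoidAlgebra k G) (v : G) (c : k) : Prop :=
  F.coeff v = c ∧ ∀ w, F.coeff w ≠ 0 → w ≤ v

namespace IsLead

variable {F H : AddMonoidAlgebra k G} {v w : G} {c c' : k}

theorem mono (h : IsLead F v c) (hvw : v < w) : IsLead F w 0 := by
  refine ⟨?_, fun u hu => (h.2 u hu).trans hvw.le⟩
  by_contra h0
  exact absurd (h.2 w h0) (not_le.2 hvw)

theorem single (v : G) (c : k) : IsLead (AddMonoidAlgebra.single v c) v c := by
  classical
  refine ⟨by simp, fun u hu => ?_⟩
  rw [AddMonoidAlgebra.coeff_single, Finsupp.single_apply] at hu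
  simp only [ne_eq, ite_eq_right_iff, not_forall] at hu
  exact hu.1.symm.le

theorem unique (h : IsLead F v c) (hc : c ≠ 0) (h' : IsLead F w c') (hc' : c' ≠ 0) : v = w :=
  le_antisymm (h'.2 v (by rw [h.1]; exact hc)) (h.2 w (by rw [h'.1]; exact hc'))

variable [AddCommGroup G]

theorem zero (v : G) : IsLead (0 : AddMonoidAlgebra k G) v 0 := by
  simp [IsLead]

theorem add (h : IsLead F v c) (h' : IsLead H v c') : IsLead (F + H) v (c + c') := by
  refine ⟨by simp [h.1, h'.1], fun u hu => ?_⟩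
  by_cases h0 : F.coeff u = 0
  · exact h'.2 u fun h1 => hu (by simp [h0, h1])
  · exact h.2 u h0

theorem smul (a : k) (h : IsLead F v c) : IsLead (a • F) v (a * c) := by
  refine ⟨by simp [h.1], fun u hu => h.2 u fun h0 => hu (by simp [h0])⟩

theorem sum {ι : Type*} {S : Finset ι} {F : ι → AddMonoidAlgebra k G} {c : ι → k}
    (h : ∀ i ∈ S, IsLead (F i) v (c i)) : IsLead (∑ i ∈ S, F i) v (∑ i ∈ S, c i) := by
  classical
  induction S using Finset.induction_on with
  | empty => simpa using zero v
  | insert a S ha ih =>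
    rw [Finset.sum_insert ha, Finset.sum_insert ha]
    exact (h a (by simp)).add (ih fun i hi => h i (by simp [hi]))

theorem mul [IsOrderedAddMonoid G] (h : IsLead F v c) (h' : IsLead H w c') :
    IsLead (F * H) (v + w) (c * c') := by
  classical
  constructor
  · rw [← h.1, ← h'.1]
    apply AddMonoidAlgebra.coeff_mul_add_of_uniqueAdd
    intro a b ha hb hab
    have h1 := h.2 a (by simpa using ha)
    have h2 := h'.2 b (by simpa using hb)
    exact ((add_eq_add_iff_eq_and_eq h1 h2).1 hab)
  · intro u hu
    have := AddMonoidAlgebra.support_coeff_mul_subset F H (by simpa using hu)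
    obtain ⟨a, ha, b, hb, rfl⟩ := Finset.mem_add.1 this
    exact add_le_add (h.2 a (by simpa using ha)) (h'.2 b (by simpa using hb))

theorem pow [IsOrderedAddMonoid G] (h : IsLead F v c) (n : ℕ) :
    IsLead (F ^ n) (n • v) (c ^ n) := by
  induction n with
  | zero => simpa [AddMonoidAlgebra.one_def] using single (0 : G) (1 : k)
  | succ n ih => rw [pow_succ, pow_succ, succ_nsmul]; exact ih.mul h

theorem ne_zero (h : IsLead F v c) (hc : c ≠ 0) : F ≠ 0 := by
  rintro rfl
  exact hc (by simpa using h.1.symm)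

theorem exists_of_ne_zero (h : F ≠ 0) : ∃ v c, c ≠ 0 ∧ IsLead F v c := by
  have hne : F.coeff.support.Nonempty := by
    rw [Finsupp.support_nonempty_iff]
    simpa using h
  refine ⟨F.coeff.support.max' hne, _, ?_, rfl, fun w hw =>
    Finset.le_max' _ _ (by simpa using hw)⟩
  simpa using Finset.max'_mem _ hne

/-- Two elements, not both zero, have a common bound on the exponents which is attained. -/
theorem exists_common (h : F ≠ 0 ∨ H ≠ 0) :
    ∃ v c c', (c ≠ 0 ∨ c' ≠ 0) ∧ IsLead F v c ∧ IsLead H v c' := by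
  by_cases hF : F = 0
  · obtain ⟨v, c, hc, hl⟩ := exists_of_ne_zero (h.resolve_left (not_not.2 hF))
    exact ⟨v, 0, c, Or.inr hc, hF ▸ zero v, hl⟩
  by_cases hH : H = 0
  · obtain ⟨v, c, hc, hl⟩ := exists_of_ne_zero hF
    exact ⟨v, c, 0, Or.inl hc, hl, hH ▸ zero v⟩
  obtain ⟨v, c, hc, hl⟩ := exists_of_ne_zero hF
  obtain ⟨w, c', hc', hl'⟩ := exists_of_ne_zero hH
  rcases lt_trichotomy v w with hlt | rfl | hlt
  · exact ⟨w, 0, c', Or.inr hc', hl.mono hlt, hl'⟩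
  · exact ⟨v, c, c', Or.inl hc, hl, hl'⟩
  · exact ⟨v, c, 0, Or.inl hc, hl, hl'.mono hlt⟩

end IsLead

theorem IsLead.eulerDer [AddCommGroup G] {F : AddMonoidAlgebra k G} {v : G} {c : k}
    (h : IsLead F v c) (χ : G →+ k) : IsLead (eulerDer χ F) v (χ v * c) := by
  refine ⟨by rw [eulerDer_coeff, h.1], fun w hw => h.2 w fun h0 => hw ?_⟩
  rw [eulerDer_coeff, h0, mul_zero]

end Leading

section Spanning

variable {k G R ι : Type*} [Field k] [LinearOrder G] [AddCommGroup G] [CommRing R] [Algebra k R]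
  {φ : R →ₐ[k] AddMonoidAlgebra k G} {w : ι → R} {E : ι → G}

/-- If the images of the `w i` are monic with pairwise distinct leading exponents, then a nonzero
combination of the `w i` has the leading exponent of one of the terms occurring in it. -/
theorem exists_lead_of_mem_span (hE : Function.Injective E)
    (hw : ∀ i, IsLead (φ (w i)) (E i) 1) {b : R} (hb : b ∈ Submodule.span k (Set.range w))
    (hb0 : b ≠ 0) :
    ∃ (t : ι) (c : k), c ≠ 0 ∧ IsLead (φ b) (E t) c ∧
      b ∈ Submodule.span k (w '' {i | E i ≤ E t}) := by
  classical
  obtain ⟨a, rfl⟩ := (Finsupp.mem_span_range_iff_exists_finsupp).1 hb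
  have hne : a.support.Nonempty := by
    rw [Finsupp.support_nonempty_iff]
    rintro rfl
    simp at hb0
  obtain ⟨t, ht, hmax⟩ := Finset.exists_max_image a.support E hne
  refine ⟨t, a t, by simpa using ht, ?_, ?_⟩
  · rw [Finsupp.sum, map_sum]
    have : a t = ∑ i ∈ a.support, if i = t then a t else 0 := by
      rw [Finset.sum_ite_eq' a.support t, if_pos ht]
    rw [this]
    refine IsLead.sum fun i hi => ?_
    rw [map_smul]
    split_ifs with h
    · subst h
      simpa using (hw i).smul (a i)
    · exact ((hw i).smul (a i)).mono ((hmax i hi).lt_of_ne fun h' => h (hE h'))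
  · refine Submodule.sum_mem _ fun i hi => Submodule.smul_mem _ _ (Submodule.subset_span ?_)
    exact ⟨i, hmax i hi, rfl⟩

theorem injective_of_span_eq_top (hE : Function.Injective E)
    (hw : ∀ i, IsLead (φ (w i)) (E i) 1) (hspan : Submodule.span k (Set.range w) = ⊤) :
    Function.Injective φ := by
  rw [injective_iff_map_eq_zero]
  intro b hb
  by_contra hb0
  obtain ⟨t, c, hc, hl, -⟩ := exists_lead_of_mem_span hE hw (hspan ▸ Submodule.mem_top) hb0
  exact hl.ne_zero hc hb

end Spanning

section Derivations

variable {k R A : Type*} [CommRing k] [CommRing R] [Algebra k R] [CommRing A] [Algebra k A]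

/-- The subalgebra on which a derivation of `R` and a derivation of `A` are compatible. -/
def eqSubalgebra (φ : R →ₐ[k] A) (D : Derivation k R R) (δ : Derivation k A A) :
    Subalgebra k R where
  carrier := {b | φ (D b) = δ (φ b)}
  mul_mem' {a b} ha hb := by
    simp only [Set.mem_ofPred_eq] at ha hb ⊢
    simp [ha, hb]
  add_mem' {a b} ha hb := by
    simp only [Set.mem_ofPred_eq] at ha hb ⊢
    simp [ha, hb]
  algebraMap_mem' r := by simp

theorem mem_eqSubalgebra {φ : R →ₐ[k] A} {D : Derivation k R R} {δ : Derivation k A A} {b : R} :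
    b ∈ eqSubalgebra φ D δ ↔ φ (D b) = δ (φ b) := Iff.rfl

theorem mem_eqSubalgebra_of_mul {φ : R →ₐ[k] A} {D : Derivation k R R} {δ : Derivation k A A}
    {t b : R} (ht : t ∈ eqSubalgebra φ D δ) (htb : t * b ∈ eqSubalgebra φ D δ)
    (hu : IsUnit (φ t)) : b ∈ eqSubalgebra φ D δ := by
  rw [mem_eqSubalgebra] at *
  simp only [Derivation.leibniz, map_add, smul_eq_mul, map_mul, ht] at htb
  exact hu.mul_left_cancel (add_right_cancel htb)

/-- The elements whose image is sent back to the image of `φ` by a derivation `δ`. -/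
def stableSubalgebra (φ : R →ₐ[k] A) (δ : Derivation k A A) : Subalgebra k R where
  carrier := {b | δ (φ b) ∈ φ.range}
  mul_mem' {a b} ha hb := by
    simp only [Set.mem_ofPred_eq, map_mul, Derivation.leibniz, smul_eq_mul] at ha hb ⊢
    exact add_mem (mul_mem ⟨a, rfl⟩ hb) (mul_mem ⟨b, rfl⟩ ha)
  add_mem' {a b} ha hb := by
    simp only [Set.mem_ofPred_eq, map_add] at ha hb ⊢
    exact add_mem ha hb
  algebraMap_mem' r := ⟨0, by simp⟩

theorem exists_derivation_restrict {φ : R →ₐ[k] A} (hφ : Function.Injective φ)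
    {δ : Derivation k A A} (h : stableSubalgebra φ δ = ⊤) :
    ∃ D : Derivation k R R, ∀ b, φ (D b) = δ (φ b) := by
  have h' : ∀ b, ∃ c, φ c = δ (φ b) := fun b =>
    (h ▸ Algebra.mem_top : b ∈ stableSubalgebra φ δ)
  choose D hD using h'
  refine ⟨Derivation.mk'
    { toFun := D
      map_add' := fun a b => hφ (by simp [hD])
      map_smul' := fun a b => hφ (by simp [hD]) }
    fun a b => hφ (by simp [hD]), hD⟩

/-- The value at `(x, t)` of the polynomial in `t` that is monic of degree `d` with the other
coefficients `f i (x)`. -/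
noncomputable def polyAt (d : ℕ) (f : ℕ → Polynomial k) (x t : R) : R :=
  t ^ d + ∑ i ∈ Finset.range d, Polynomial.aeval x (f i) * t ^ i

/-- The value at `(x, t)` of the derivative in `t` of the polynomial of `polyAt`. -/
noncomputable def polyDerivAt (d : ℕ) (f : ℕ → Polynomial k) (x t : R) : R :=
  d * t ^ (d - 1) + ∑ i ∈ Finset.range d, i * Polynomial.aeval x (f i) * t ^ (i - 1)

theorem map_polyAt (φ : R →ₐ[k] A) (d : ℕ) (f : ℕ → Polynomial k) (x t : R) :
    φ (polyAt d f x t) = polyAt d f (φ x) (φ t) := by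
  simp [polyAt, Polynomial.aeval_algHom_apply]

theorem map_polyDerivAt (φ : R →ₐ[k] A) (d : ℕ) (f : ℕ → Polynomial k) (x t : R) :
    φ (polyDerivAt d f x t) = polyDerivAt d f (φ x) (φ t) := by
  simp [polyDerivAt, Polynomial.aeval_algHom_apply]

theorem derivation_polyAt (D : Derivation k R R) {x : R} (hx : D x = 0) (d : ℕ)
    (f : ℕ → Polynomial k) (t : R) :
    D (polyAt d f x t) = polyDerivAt d f x t * D t := by
  simp only [polyAt, polyDerivAt, map_add, map_sum, Derivation.leibniz, Derivation.leibniz_pow,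
    Derivation.map_aeval, hx, smul_eq_mul, nsmul_eq_mul, add_mul,
    Finset.sum_mul]
  congr 1
  · ring
  · exact Finset.sum_congr rfl fun i _ => by ring

theorem aeval_mem_subalgebra {S : Subalgebra k R} {x : R} (hx : x ∈ S) (p : Polynomial k) :
    Polynomial.aeval x p ∈ S :=
  (Algebra.adjoin_le (Set.singleton_subset_iff.2 hx)) (Polynomial.aeval_mem_adjoin_singleton k x)

theorem polyAt_mem {S : Subalgebra k R} {x t : R} (hx : x ∈ S) (ht : t ∈ S) (d : ℕ)
    (f : ℕ → Polynomial k) : polyAt d f x t ∈ S :=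
  add_mem (pow_mem ht d)
    (sum_mem fun i _ => mul_mem (aeval_mem_subalgebra hx (f i)) (pow_mem ht i))

end Derivations

section Iterate

variable {k G R : Type*} [Field k] [LinearOrder G] [AddCommGroup G] [CommRing R] [Algebra k R]
  {φ : R →ₐ[k] AddMonoidAlgebra k G} {D : Derivation k R R} {u : G} {ψ : G →+ k}

theorem IsLead.iterate
    (h : ∀ b v c, IsLead (φ b) v c → IsLead (φ (D b)) (v + u) (ψ v * c))
    {b : R} {v : G} {c : k} (hb : IsLead (φ b) v c) (N : ℕ) :
    IsLead (φ (((D.toLinearMap : Module.End k R) ^ N) b)) (v + N • u)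
      ((∏ t ∈ Finset.range N, (ψ v + t * ψ u)) * c) := by
  induction N with
  | zero => simpa using hb
  | succ N ih =>
    rw [pow_succ', Module.End.mul_apply]
    convert h _ _ _ ih using 1
    · rfl
    · rw [succ_nsmul, add_assoc]
    · rw [Finset.prod_range_succ, map_add, map_nsmul, nsmul_eq_mul]
      ring

theorem exists_weight_eq_zero
    (h : ∀ b v c, IsLead (φ b) v c → IsLead (φ (D b)) (v + u) (ψ v * c))
    {b : R} {v : G} {c : k} (hc : c ≠ 0) (hb : IsLead (φ b) v c) {N : ℕ}
    (hN : ((D.toLinearMap : Module.End k R) ^ N) b = 0) :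
    ∃ t < N, ψ v + t * ψ u = 0 := by
  have := IsLead.iterate h hb N
  rw [hN, map_zero] at this
  by_contra! hne
  refine this.ne_zero (mul_ne_zero (Finset.prod_ne_zero_iff.2 fun t ht => ?_) hc) rfl
  exact hne t (Finset.mem_range.1 ht)

end Iterate

theorem eq_of_mixed_radix {d m a b c a' b' c' : ℕ} (ha : a < d) (ha' : a' < d) (hb : b < m)
    (hb' : b' < m) (h : a + d * b + m * d * c = a' + d * b' + m * d * c') :
    a = a' ∧ b = b' ∧ c = c' := by
  have h1 : a + d * (b + m * c) = a' + d * (b' + m * c') := by linarith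
  have h2 : a = a' := by
    have := congrArg (· % d) h1
    simpa [Nat.add_mul_mod_self_left, Nat.mod_eq_of_lt ha, Nat.mod_eq_of_lt ha'] using this
  have h3 : b + m * c = b' + m * c' := by
    subst h2
    exact Nat.eq_of_mul_eq_mul_left (by lia) (add_left_cancel h1)
  have h4 : b = b' := by
    have := congrArg (· % m) h3
    simpa [Nat.add_mul_mod_self_left, Nat.mod_eq_of_lt hb, Nat.mod_eq_of_lt hb'] using this
  subst h4
  exact ⟨h2, rfl, Nat.eq_of_mul_eq_mul_left (by lia) (add_left_cancel h3)⟩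

/-- The leading exponents `(r, u)`, in `s` and in `x`, of the elements `xⁱ sᵃ yᵇ zᶜ` with
`a < d` and `b < m`. -/
def IsExponent (n e d m : ℕ) (r u : ℤ) : Prop :=
  ∃ i a b c : ℕ, a < d ∧ b < m ∧ r = a + d * b + m * d * c ∧ u = i - n * b - (e + n * m) * c

theorem no_positive_weight {n e d m : ℕ} (hn : 1 ≤ n) (hne : ¬(n = 1 ∧ e = 0)) (hd : 2 ≤ d)
    (hm : 2 ≤ m) {P Q u r : ℤ} (hP : 0 < P) (h : P * u + Q * r = -1)
    (hy : 0 ≤ Q * d - P * n) (hz : 0 ≤ Q * (m * d) - P * (e + n * m))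
    (hx : IsExponent n e d m r (u + 1)) (hs : 0 < Q → IsExponent n e d m (r + 1) u)
    (hyΓ : 0 < Q * d - P * n → IsExponent n e d m (r + d) (u - n)) : False := by
  obtain ⟨i, a, b, c, ha, hb, rfl, hu⟩ := hx
  have hQ : 0 < Q := by
    have : (0:ℤ) < P * n := by positivity
    by_contra hQ
    nlinarith
  have hi : i = 0 := by
    by_contra hi
    have : (1:ℤ) ≤ i := by exact_mod_cast Nat.one_le_iff_ne_zero.2 hi
    have e1 : (0:ℤ) ≤ P * (i - 1) := mul_nonneg hP.le (by linarith)
    have e2 : (0:ℤ) ≤ b * (Q * d - P * n) := mul_nonneg (by positivity) hy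
    have e3 : (0:ℤ) ≤ c * (Q * (m * d) - P * (e + n * m)) := mul_nonneg (by positivity) hz
    have e4 : (0:ℤ) ≤ Q * a := by positivity
    have e5 : u = i - n * b - (e + n * m) * c - 1 := by linarith
    rw [e5] at h
    linarith
  subst hi
  have ha' : a + 1 = d := by
    by_contra hne'
    obtain ⟨i', a', b', c', ha', hb', hr, hu'⟩ := hs hQ
    obtain ⟨rfl, rfl, rfl⟩ := eq_of_mixed_radix (a := a + 1) (c := c) (c' := c') (by lia) ha' hb hb'
      (by zify; linarith)
    push_cast at hu
    lia
  have hb'' : 0 < e → b + 1 = m := by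
    intro he
    have hpos : 0 < Q * d - P * n := by
      have : (0:ℤ) < P * e := by positivity
      have : 0 < m * (Q * d - P * n) := by linarith
      exact pos_of_mul_pos_right this (by positivity)
    by_contra hne'
    obtain ⟨i', a', b', c', ha', hb', hr, hu'⟩ := hyΓ hpos
    obtain ⟨rfl, rfl, rfl⟩ := eq_of_mixed_radix (b := b + 1) (c := c) (c' := c') ha ha' (by lia) hb'
      (by zify; linarith)
    push_cast at hu hu'
    nlinarith
  have e5 : u = - n * b - (e + n * m) * c - 1 := by push_cast at hu; linarith
  have e3 : (0:ℤ) ≤ c * (Q * (m * d) - P * (e + n * m)) := mul_nonneg (by positivity) hz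
  have e6 : Q * (d - 1) + b * (Q * d - P * n) < P := by
    have : (a : ℤ) = d - 1 := by lia
    rw [e5, this] at h
    linarith
  have hd' : (2:ℤ) ≤ d := by exact_mod_cast hd
  have hm' : (2:ℤ) ≤ m := by exact_mod_cast hm
  have hQd : Q * d ≤ 2 * (Q * (d - 1)) := by nlinarith
  rcases Nat.eq_zero_or_pos e with rfl | he
  · have hn' : (2:ℤ) ≤ n := by lia
    have : (0:ℤ) ≤ b * (Q * d - P * n) := mul_nonneg (by positivity) hy
    nlinarith
  · have hb3 : (b : ℤ) = m - 1 := by have := hb'' he; lia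
    have he' : (1:ℤ) ≤ e := by exact_mod_cast he
    have hn' : (1:ℤ) ≤ n := by exact_mod_cast hn
    rw [hb3] at e6
    have h1 : P ≤ m * (Q * d - P * n) := by nlinarith
    have h2 : m * (Q * d - P * n) ≤ 2 * ((m - 1) * (Q * d - P * n)) := by nlinarith
    have h3 : P ≤ Q * d := by nlinarith
    linarith

section Laurent

theorem nsmul_toLex (N : ℕ) (j i : ℤ) : N • toLex (j, i) = toLex (N * j, N * i) := by
  induction N with
  | zero =>
    rw [zero_nsmul, Nat.cast_zero, zero_mul, zero_mul]
    rfl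
  | succ N ih =>
    rw [succ_nsmul, ih, ← toLex_add, Prod.mk_add_mk]
    push_cast
    rw [add_one_mul, add_one_mul]

variable (k : Type*) [Field k]

/-- The monomial `sʲ xⁱ` in the ring of Laurent polynomials in `s` and `x`, whose exponents
are ordered lexicographically with `s` first. -/
noncomputable def mon (j i : ℤ) : AddMonoidAlgebra k (ℤ ×ₗ ℤ) :=
  AddMonoidAlgebra.single (toLex (j, i)) 1

/-- The exponent of `s` as an additive map to `k`. -/
def sExp : (ℤ ×ₗ ℤ) →+ k where
  toFun v := ((ofLex v).1 : k)
  map_zero' := by simp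
  map_add' v w := by simp

/-- The exponent of `x` as an additive map to `k`. -/
def xExp : (ℤ ×ₗ ℤ) →+ k where
  toFun v := ((ofLex v).2 : k)
  map_zero' := by simp
  map_add' v w := by simp

theorem sExp_toLex (j i : ℤ) : sExp k (toLex (j, i)) = j := rfl

theorem xExp_toLex (j i : ℤ) : xExp k (toLex (j, i)) = i := rfl

theorem lead_mon (j i : ℤ) : IsLead (mon k j i) (toLex (j, i)) 1 := IsLead.single _ _

theorem mon_mul (j i j' i' : ℤ) : mon k j i * mon k j' i' = mon k (j + j') (i + i') := by
  rw [mon, mon, mon, AddMonoidAlgebra.single_mul_single, one_mul]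
  rfl

theorem mon_zero : mon k 0 0 = 1 := rfl

theorem mon_pow (j i : ℤ) (N : ℕ) : mon k j i ^ N = mon k (N * j) (N * i) := by
  rw [mon, AddMonoidAlgebra.single_pow, one_pow, nsmul_toLex, mon]

theorem isUnit_mon (j i : ℤ) : IsUnit (mon k j i) :=
  IsUnit.of_mul_eq_one (mon k (-j) (-i)) (by simp [mon_mul, mon_zero])

variable {k}

theorem lead_aeval (p : Polynomial k) :
    IsLead (Polynomial.aeval (mon k 0 1) p) (toLex (0, (p.natDegree : ℤ) + 1)) 0 := by
  rw [Polynomial.aeval_eq_sum_range]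
  have h0 : (∑ _i ∈ Finset.range (p.natDegree + 1), (0 : k)) = 0 := Finset.sum_const_zero
  rw [← h0]
  refine IsLead.sum fun i hi => ?_
  rw [mon_pow]
  refine ((lead_mon k _ _).smul _).mono ?_
  rw [Prod.Lex.toLex_lt_toLex]
  right
  have := Finset.mem_range.1 hi
  constructor <;> push_cast <;> lia

theorem lead_polyAt {F : AddMonoidAlgebra k (ℤ ×ₗ ℤ)} {j i : ℤ} (hj : 0 < j)
    (hF : IsLead F (toLex (j, i)) 1) (d : ℕ) (f : ℕ → Polynomial k) :
    IsLead (polyAt d f (mon k 0 1) F) (toLex (d * j, d * i)) 1 := by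
  have h1 : IsLead (F ^ d) (toLex (d * j, d * i)) 1 := by
    have := hF.pow d
    rwa [nsmul_toLex, one_pow] at this
  have h2 : IsLead (∑ i ∈ Finset.range d, Polynomial.aeval (mon k 0 1) (f i) * F ^ i)
      (toLex (d * j, d * i)) (∑ i ∈ Finset.range d, 0) := by
    refine IsLead.sum fun t ht => ?_
    have h3 := (lead_aeval (f t)).mul (hF.pow t)
    rw [zero_mul] at h3
    refine h3.mono ?_
    rw [nsmul_toLex, ← toLex_add, Prod.mk_add_mk, Prod.Lex.toLex_lt_toLex]
    left
    have : (t : ℤ) < d := by exact_mod_cast Finset.mem_range.1 ht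
    simp only [zero_add]
    exact mul_lt_mul_of_pos_right this hj
  simpa [polyAt] using h1.add h2

/-- The image of `y` in the Laurent polynomials. -/
noncomputable def yLaurent (n d : ℕ) (f : ℕ → Polynomial k) : AddMonoidAlgebra k (ℤ ×ₗ ℤ) :=
  mon k 0 (-n) * polyAt d f (mon k 0 1) (mon k 1 0)

/-- The image of `z` in the Laurent polynomials. -/
noncomputable def zLaurent (n e d m : ℕ) (f g : ℕ → Polynomial k) :
    AddMonoidAlgebra k (ℤ ×ₗ ℤ) :=
  mon k 0 (-e) * (polyAt m g (mon k 0 1) (yLaurent n d f) - mon k 1 0)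

theorem lead_yLaurent (n d : ℕ) (f : ℕ → Polynomial k) :
    IsLead (yLaurent n d f) (toLex ((d : ℤ), -(n : ℤ))) 1 := by
  have := (lead_mon k 0 (-n)).mul (lead_polyAt one_pos (lead_mon k 1 0) d f)
  rw [← toLex_add, Prod.mk_add_mk] at this
  simpa [yLaurent] using this

theorem lead_zLaurent (n e : ℕ) {d m : ℕ} (hd : 2 ≤ d) (hm : 2 ≤ m) (f g : ℕ → Polynomial k) :
    IsLead (zLaurent n e d m f g) (toLex ((m : ℤ) * d, -((e : ℤ) + n * m))) 1 := by
  have h1 := lead_polyAt (by lia) (lead_yLaurent n d f) m g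
  have hlt : toLex ((1 : ℤ), (0 : ℤ)) < toLex ((m : ℤ) * d, (m : ℤ) * -(n : ℤ)) := by
    rw [Prod.Lex.toLex_lt_toLex]
    left
    have : (2 : ℤ) ≤ m := by exact_mod_cast hm
    have : (2 : ℤ) ≤ d := by exact_mod_cast hd
    nlinarith
  have h2 := h1.add (((lead_mon k 1 0).mono hlt).smul (-1))
  have h3 := (lead_mon k 0 (-e)).mul h2
  rw [← toLex_add, Prod.mk_add_mk, neg_one_smul, ← sub_eq_add_neg] at h3
  have h4 : ((m : ℤ) * d, -((e : ℤ) + n * m)) = (0 + (m : ℤ) * d, -(e : ℤ) + m * -(n : ℤ)) :=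
    Prod.ext (by ring) (by ring)
  rw [h4]
  simpa [zLaurent] using h3

theorem mon_mul_yLaurent (n d : ℕ) (f : ℕ → Polynomial k) :
    mon k 0 1 ^ n * yLaurent n d f = polyAt d f (mon k 0 1) (mon k 1 0) := by
  rw [yLaurent, ← mul_assoc, mon_pow, mon_mul]
  simp [mon_zero]

theorem mon_mul_zLaurent (n e d m : ℕ) (f g : ℕ → Polynomial k) :
    mon k 0 1 ^ e * zLaurent n e d m f g =
      polyAt m g (mon k 0 1) (yLaurent n d f) - mon k 1 0 := by
  rw [zLaurent, ← mul_assoc, mon_pow, mon_mul]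
  simp [mon_zero]

theorem eulerDer_mon (χ : (ℤ ×ₗ ℤ) →+ k) (j i : ℤ) :
    eulerDer χ (mon k j i) = χ (toLex (j, i)) • mon k j i := by
  rw [mon, eulerDer_single, AddMonoidAlgebra.smul_single, smul_eq_mul]

end Laurent

section Span

variable {k A : Type*} [CommRing k] [CommRing A] [Algebra k A] {W : Submodule k A}

theorem submodule_eq_top_of_mul_mem {S : Set A} (hS : Algebra.adjoin k S = ⊤) (h1 : 1 ∈ W)
    (h : ∀ t ∈ S, ∀ v ∈ W, t * v ∈ W) : W = ⊤ := by
  have key : ∀ b ∈ Algebra.adjoin k S, ∀ v ∈ W, b * v ∈ W := by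
    intro b hb
    induction hb using Algebra.adjoin_induction with
    | mem t ht => exact h t ht
    | algebraMap r => exact fun v hv => by simpa [Algebra.smul_def] using W.smul_mem r hv
    | add a b _ _ ha hb => exact fun v hv => by simpa [add_mul] using W.add_mem (ha v hv) (hb v hv)
    | mul a b _ _ ha hb => exact fun v hv => by simpa [mul_assoc] using ha _ (hb v hv)
  refine (Submodule.eq_top_iff').2 fun b => ?_
  simpa using key b (hS ▸ Algebra.mem_top) 1 h1

theorem aeval_mul_mem {x : A} (hx : ∀ v ∈ W, x * v ∈ W) (p : Polynomial k) :
    ∀ v ∈ W, Polynomial.aeval x p * v ∈ W := by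
  induction p using Polynomial.induction_on' with
  | add p q hp hq => exact fun v hv => by simpa [add_mul] using W.add_mem (hp v hv) (hq v hv)
  | monomial N a =>
    intro v hv
    rw [Polynomial.aeval_monomial, mul_assoc, ← Algebra.smul_def]
    refine W.smul_mem a ?_
    induction N with
    | zero => simpa using hv
    | succ N ih => simpa [pow_succ', mul_assoc] using hx _ ih

/-- Lowering the degree in `t` by means of the relation `u = polyAt d f x t`. -/
theorem mul_pow_mem_of_polyAt {x : A} (hx : ∀ v ∈ W, x * v ∈ W) {d : ℕ}
    {f : ℕ → Polynomial k} {t u v : A} (h : u = polyAt d f x t) (hu : v * u ∈ W)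
    (hlow : ∀ i < d, v * t ^ i ∈ W) : v * t ^ d ∈ W := by
  have : v * t ^ d =
      v * u - ∑ i ∈ Finset.range d, Polynomial.aeval x (f i) * (v * t ^ i) := by
    rw [h, polyAt, mul_add, Finset.mul_sum, add_sub_assoc, ← Finset.sum_sub_distrib,
      Finset.sum_eq_zero fun i _ => by ring, add_zero]
  rw [this]
  exact W.sub_mem hu (W.sum_mem fun i hi =>
    aeval_mul_mem hx (f i) _ (hlow i (Finset.mem_range.1 hi)))

end Span

theorem IsExponent.nonneg {n e d m : ℕ} {r u : ℤ} (h : IsExponent n e d m r u) : 0 ≤ r := by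
  obtain ⟨i, a, b, c, -, -, rfl, -⟩ := h
  positivity

/-- The exponents of the leading monomials of the elements `xⁱ sᵃ yᵇ zᶜ`, for `t = (i, a, b, c)`. -/
def famExp (n e d m : ℕ) (t : ℕ × Fin d × Fin m × ℕ) : ℤ ×ₗ ℤ :=
  toLex ((t.2.1 : ℕ) + d * (t.2.2.1 : ℕ) + m * d * t.2.2.2,
    t.1 - n * (t.2.2.1 : ℕ) - (e + n * m) * t.2.2.2)

theorem famExp_injective (n e d m : ℕ) : Function.Injective (famExp n e d m) := by
  rintro ⟨i, a, b, c⟩ ⟨i', a', b', c'⟩ h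
  have h1 := congrArg (fun v => (ofLex v).1) h
  have h2 := congrArg (fun v => (ofLex v).2) h
  simp only [famExp, ofLex_toLex] at h1 h2
  obtain ⟨ha, hb, rfl⟩ := eq_of_mixed_radix a.2 a'.2 b.2 b'.2 (by exact_mod_cast h1)
  rw [hb] at h2
  simp only [sub_left_inj, Nat.cast_inj] at h2
  rw [Fin.ext ha, Fin.ext hb, h2]

/-- A ring with generators `x`, `s`, `y`, `z` subject to the relations of `R_{n,e,P,Q}`, together
with a map to the Laurent polynomials in `s` and `x`. -/
structure LaurentModel (k : Type*) [Field k] (n e d m : ℕ) (f g : ℕ → Polynomial k)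
    (R : Type*) [CommRing R] [Algebra k R] where
  /-- the generator `x` -/
  x : R
  /-- the generator `s` -/
  s : R
  /-- the generator `y` -/
  y : R
  /-- the generator `z` -/
  z : R
  /-- the map to the Laurent polynomials -/
  φ : R →ₐ[k] AddMonoidAlgebra k (ℤ ×ₗ ℤ)
  map_x : φ x = mon k 0 1
  map_s : φ s = mon k 1 0
  map_y : φ y = yLaurent n d f
  map_z : φ z = zLaurent n e d m f g
  rel_y : x ^ n * y = polyAt d f x s
  rel_z : s + x ^ e * z = polyAt m g x y
  adjoin_eq_top : Algebra.adjoin k {x, s, y, z} = ⊤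

namespace LaurentModel

variable {k : Type*} [Field k] {n e d m : ℕ} {f g : ℕ → Polynomial k} {R : Type*} [CommRing R]
  [Algebra k R] (M : LaurentModel k n e d m f g R)

/-- The spanning family `xⁱ sᵃ yᵇ zᶜ` with `a < d` and `b < m`. -/
def fam (t : ℕ × Fin d × Fin m × ℕ) : R :=
  M.x ^ t.1 * M.s ^ (t.2.1 : ℕ) * M.y ^ (t.2.2.1 : ℕ) * M.z ^ t.2.2.2

theorem lead_fam (hd : 2 ≤ d) (hm : 2 ≤ m) (t : ℕ × Fin d × Fin m × ℕ) :
    IsLead (M.φ (M.fam t)) (famExp n e d m t) 1 := by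
  have h := ((((lead_mon k 0 1).pow t.1).mul ((lead_mon k 1 0).pow t.2.1)).mul
    ((lead_yLaurent n d f).pow t.2.2.1)).mul ((lead_zLaurent n e hd hm f g).pow t.2.2.2)
  simp only [nsmul_toLex, ← toLex_add, Prod.mk_add_mk, one_pow, mul_one] at h
  have h4 : famExp n e d m t =
      toLex (t.1 * 0 + (t.2.1 : ℕ) + (t.2.2.1 : ℕ) * (d : ℤ) + t.2.2.2 * ((m : ℤ) * d),
        t.1 + (t.2.1 : ℕ) * 0 + (t.2.2.1 : ℕ) * -(n : ℤ) + t.2.2.2 * -((e : ℤ) + n * m)) :=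
    congrArg toLex (Prod.ext (by ring) (by ring))
  rw [fam, map_mul, map_mul, map_mul, map_pow, map_pow, map_pow, map_pow, M.map_x, M.map_s,
    M.map_y, M.map_z, h4]
  exact h

theorem span_fam (hd : 2 ≤ d) (hm : 2 ≤ m) : Submodule.span k (Set.range M.fam) = ⊤ := by
  set W := Submodule.span k (Set.range M.fam) with hW
  have hx : ∀ v ∈ W, M.x * v ∈ W := by
    intro v hv
    induction hv using Submodule.span_induction with
    | mem v hv =>
      obtain ⟨⟨i, a, b, c⟩, rfl⟩ := hv
      refine Submodule.subset_span ⟨(i + 1, a, b, c), ?_⟩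
      simp only [fam]
      ring
    | zero => simp
    | add v w _ _ hv hw => simpa [mul_add] using W.add_mem hv hw
    | smul r v _ hv => simpa using W.smul_mem r hv
  have hmono : ∀ N i a b c : ℕ, a + b = N → M.x ^ i * M.s ^ a * M.y ^ b * M.z ^ c ∈ W := by
    intro N
    induction N using Nat.strong_induction_on with
    | _ N ih =>
    rintro i a b c rfl
    by_cases ha : a < d
    · by_cases hb : b < m
      · exact Submodule.subset_span ⟨(i, ⟨a, ha⟩, ⟨b, hb⟩, c), rfl⟩
      · obtain ⟨b, rfl⟩ := Nat.exists_eq_add_of_le' (not_lt.1 hb)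
        have := mul_pow_mem_of_polyAt hx M.rel_z
          (v := M.x ^ i * M.s ^ a * M.y ^ b * M.z ^ c) ?_ ?_
        · convert this using 1
          ring
        · convert W.add_mem (ih _ (by lia) i (a + 1) b c rfl)
            (ih _ (by lia) (i + e) a b (c + 1) rfl) using 1
          ring
        · intro j hj
          convert ih _ (by lia) i a (b + j) c rfl using 1
          ring
    · obtain ⟨a, rfl⟩ := Nat.exists_eq_add_of_le' (not_lt.1 ha)
      have := mul_pow_mem_of_polyAt hx M.rel_y
        (v := M.x ^ i * M.s ^ a * M.y ^ b * M.z ^ c) ?_ ?_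
      · convert this using 1
        ring
      · convert ih _ (by lia) (i + n) a (b + 1) c rfl using 1
        ring
      · intro j hj
        convert ih _ (by lia) i (a + j) b c rfl using 1
        ring
  refine submodule_eq_top_of_mul_mem M.adjoin_eq_top ?_ ?_
  · simpa using hmono _ 0 0 0 0 rfl
  · intro t ht v hv
    induction hv using Submodule.span_induction with
    | mem v hv =>
      obtain ⟨⟨i, a, b, c⟩, rfl⟩ := hv
      simp only [Set.mem_insert_iff, Set.mem_singleton_iff] at ht
      rcases ht with rfl | rfl | rfl | rfl
      · convert hmono _ (i + 1) a b c rfl using 1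
        simp only [fam]
        ring
      · convert hmono _ i (a + 1) b c rfl using 1
        simp only [fam]
        ring
      · convert hmono _ i a (b + 1) c rfl using 1
        simp only [fam]
        ring
      · convert hmono _ i a b (c + 1) rfl using 1
        simp only [fam]
        ring
    | zero => simp
    | add v w _ _ hv hw => simpa [mul_add] using W.add_mem hv hw
    | smul r v _ hv => simpa using W.smul_mem r hv

theorem fam_mem_of_lt_mul {t : ℕ × Fin d × Fin m × ℕ}
    (ht : (t.2.1 : ℕ) + d * (t.2.2.1 : ℕ) + m * d * t.2.2.2 < m * d) :
    M.fam t ∈ Algebra.adjoin k {M.x, M.s, M.y} := by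
  have hc : t.2.2.2 = 0 := by
    by_contra hc
    have := Nat.le_mul_of_pos_right (m * d) (Nat.pos_of_ne_zero hc)
    exact absurd (this.trans (Nat.le_add_left _ _)) (not_le.2 ht)
  rw [fam, hc, pow_zero, mul_one]
  have hx : M.x ∈ Algebra.adjoin k {M.x, M.s, M.y} := Algebra.subset_adjoin (by simp)
  have hs : M.s ∈ Algebra.adjoin k {M.x, M.s, M.y} := Algebra.subset_adjoin (by simp)
  have hy : M.y ∈ Algebra.adjoin k {M.x, M.s, M.y} := Algebra.subset_adjoin (by simp)
  exact mul_mem (mul_mem (pow_mem hx _) (pow_mem hs _)) (pow_mem hy _)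

theorem fam_mem_of_lt_d (hm : 2 ≤ m) {t : ℕ × Fin d × Fin m × ℕ}
    (ht : (t.2.1 : ℕ) + d * (t.2.2.1 : ℕ) + m * d * t.2.2.2 < d) :
    M.fam t ∈ Algebra.adjoin k {M.x, M.s} := by
  have hc : t.2.2.2 = 0 := by
    by_contra hc
    have := (Nat.le_mul_of_pos_left d (show 0 < m by lia)).trans
      (Nat.le_mul_of_pos_right (m * d) (Nat.pos_of_ne_zero hc))
    exact absurd (this.trans (Nat.le_add_left _ _)) (not_le.2 ht)
  have hb : (t.2.2.1 : ℕ) = 0 := by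
    by_contra hb
    have := Nat.le_mul_of_pos_right d (Nat.pos_of_ne_zero hb)
    lia
  rw [fam, hc, hb, pow_zero, pow_zero, mul_one, mul_one]
  have hx : M.x ∈ Algebra.adjoin k {M.x, M.s} := Algebra.subset_adjoin (by simp)
  have hs : M.s ∈ Algebra.adjoin k {M.x, M.s} := Algebra.subset_adjoin (by simp)
  exact mul_mem (pow_mem hx _) (pow_mem hs _)

theorem fam_mem_of_eq_zero (hd : 2 ≤ d) (hm : 2 ≤ m) {t : ℕ × Fin d × Fin m × ℕ}
    (ht : (t.2.1 : ℕ) + d * (t.2.2.1 : ℕ) + m * d * t.2.2.2 = 0) :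
    M.fam t ∈ Algebra.adjoin k {M.x} := by
  have hmd : m * d ≠ 0 := (Nat.mul_pos (by lia) (by lia)).ne'
  simp only [Nat.add_eq_zero_iff, Nat.mul_eq_zero, hmd, false_or] at ht
  rw [fam, ht.2, ht.1.1, ht.1.2.resolve_left (by lia), pow_zero, pow_zero, pow_zero, mul_one,
    mul_one, mul_one]
  exact pow_mem (Algebra.self_mem_adjoin_singleton k M.x) _

theorem injective (hd : 2 ≤ d) (hm : 2 ≤ m) : Function.Injective M.φ :=
  injective_of_span_eq_top (famExp_injective n e d m) (M.lead_fam hd hm) (M.span_fam hd hm)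

theorem exists_lead (hd : 2 ≤ d) (hm : 2 ≤ m) {b : R} (hb : b ≠ 0) :
    ∃ (t : ℕ × Fin d × Fin m × ℕ) (c : k), c ≠ 0 ∧ IsLead (M.φ b) (famExp n e d m t) c ∧
      b ∈ Submodule.span k (M.fam '' {i | famExp n e d m i ≤ famExp n e d m t}) :=
  exists_lead_of_mem_span (famExp_injective n e d m) (M.lead_fam hd hm)
    (M.span_fam hd hm ▸ Submodule.mem_top) hb

theorem isExponent_of_isLead (hd : 2 ≤ d) (hm : 2 ≤ m) {b : R} {r u : ℤ} {c : k} (hc : c ≠ 0)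
    (h : IsLead (M.φ b) (toLex (r, u)) c) : IsExponent n e d m r u := by
  have hb : b ≠ 0 := by
    rintro rfl
    exact h.ne_zero hc (map_zero _)
  obtain ⟨t, c', hc', h', -⟩ := M.exists_lead hd hm hb
  have := toLex.injective (h.unique hc h' hc')
  exact ⟨t.1, t.2.1, t.2.2.1, t.2.2.2, t.2.1.2, t.2.2.1.2, congrArg Prod.fst this,
    congrArg Prod.snd this⟩

/-- The image of `b` has degree at most `j` in `s`. -/
def SDegLE (b : R) (j : ℤ) : Prop :=
  ∀ v c, c ≠ 0 → IsLead (M.φ b) v c → (ofLex v).1 ≤ j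

variable {M}

theorem SDegLE.of_isLead {b : R} {v : ℤ ×ₗ ℤ} {c : k} (hc : c ≠ 0) (h : IsLead (M.φ b) v c) :
    M.SDegLE b (ofLex v).1 := fun w c' hc' hw => by rw [h.unique hc hw hc']

theorem SDegLE.mono {b : R} {i j : ℤ} (h : M.SDegLE b i) (hij : i ≤ j) : M.SDegLE b j :=
  fun v c hc hv => (h v c hc hv).trans hij

theorem SDegLE.mem (hd : 2 ≤ d) (hm : 2 ≤ m) {b : R} {j : ℤ} (h : M.SDegLE b j)
    {S : Subalgebra k R}
    (hS : ∀ t : ℕ × Fin d × Fin m × ℕ,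
      (t.2.1 : ℤ) + d * (t.2.2.1 : ℤ) + m * d * t.2.2.2 ≤ j → M.fam t ∈ S) : b ∈ S := by
  by_cases hb : b = 0
  · exact hb ▸ S.zero_mem
  · obtain ⟨t, c, hc, hl, hmem⟩ := M.exists_lead hd hm hb
    refine (Submodule.span_le (p := Subalgebra.toSubmodule S)).2 ?_ hmem
    rintro _ ⟨i, hi, rfl⟩
    refine hS i (le_trans ?_ (h _ c hc hl))
    rcases (Prod.Lex.toLex_le_toLex).1 (show famExp n e d m i ≤ famExp n e d m t from hi) with
      h' | h'
    · exact h'.le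
    · exact h'.1.le

variable (M)

theorem exists_sDegLE (hd : 2 ≤ d) (hm : 2 ≤ m) (b : R) : ∃ j : ℕ, M.SDegLE b j := by
  by_cases hb : b = 0
  · refine ⟨0, fun v c hc h => ?_⟩
    exact absurd (hb ▸ map_zero M.φ) (h.ne_zero hc)
  · obtain ⟨t, c, hc, h, -⟩ := M.exists_lead hd hm hb
    refine ⟨t.2.1 + d * t.2.2.1 + m * d * t.2.2.2, ?_⟩
    have := SDegLE.of_isLead hc h
    exact_mod_cast this

theorem sDegLE_x : M.SDegLE M.x 0 :=
  SDegLE.of_isLead one_ne_zero (M.map_x ▸ lead_mon k 0 1)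

theorem sDegLE_s : M.SDegLE M.s 1 :=
  SDegLE.of_isLead one_ne_zero (M.map_s ▸ lead_mon k 1 0)

theorem sDegLE_y : M.SDegLE M.y d :=
  SDegLE.of_isLead one_ne_zero (M.map_y ▸ lead_yLaurent n d f)

theorem sDegLE_z (hd : 2 ≤ d) (hm : 2 ≤ m) : M.SDegLE M.z (m * d) :=
  SDegLE.of_isLead one_ne_zero (M.map_z ▸ lead_zLaurent n e hd hm f g)

/-- The derivation of the Laurent polynomials that extends a derivation of `R`. -/
noncomputable def extDer (D : Derivation k R R) :
    Derivation k (AddMonoidAlgebra k (ℤ ×ₗ ℤ)) (AddMonoidAlgebra k (ℤ ×ₗ ℤ)) :=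
  (mon k 0 (-1) * M.φ (D M.x)) • eulerDer (xExp k) +
    (mon k (-1) 0 * M.φ (D M.s)) • eulerDer (sExp k)

theorem map_derivation (D : Derivation k R R) (b : R) : M.φ (D b) = M.extDer D (M.φ b) := by
  have hx : M.x ∈ eqSubalgebra M.φ D (M.extDer D) := by
    rw [mem_eqSubalgebra, extDer, M.map_x]
    simp only [Derivation.add_apply, Derivation.smul_apply, eulerDer_mon, xExp_toLex, sExp_toLex,
      Int.cast_one, Int.cast_zero, one_smul, zero_smul, smul_eq_mul, mul_zero, add_zero]
    rw [mul_right_comm, mon_mul]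
    simp [mon_zero]
  have hs : M.s ∈ eqSubalgebra M.φ D (M.extDer D) := by
    rw [mem_eqSubalgebra, extDer, M.map_s]
    simp only [Derivation.add_apply, Derivation.smul_apply, eulerDer_mon, xExp_toLex, sExp_toLex,
      Int.cast_one, Int.cast_zero, one_smul, zero_smul, smul_eq_mul, mul_zero, zero_add]
    rw [mul_right_comm, mon_mul]
    simp [mon_zero]
  have hu : IsUnit (M.φ M.x) := M.map_x ▸ isUnit_mon k 0 1
  have hy : M.y ∈ eqSubalgebra M.φ D (M.extDer D) := by
    refine mem_eqSubalgebra_of_mul (pow_mem hx n) ?_ (by rw [map_pow]; exact hu.pow n)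
    rw [M.rel_y]
    exact polyAt_mem hx hs d f
  have hz : M.z ∈ eqSubalgebra M.φ D (M.extDer D) := by
    refine mem_eqSubalgebra_of_mul (pow_mem hx e) ?_ (by rw [map_pow]; exact hu.pow e)
    rw [← add_sub_cancel_left M.s (M.x ^ e * M.z), M.rel_z]
    exact sub_mem (polyAt_mem hx hy m g) hs
  have htop : (⊤ : Subalgebra k R) ≤ eqSubalgebra M.φ D (M.extDer D) := by
    rw [← M.adjoin_eq_top, Algebra.adjoin_le_iff]
    rintro _ (rfl | rfl | rfl | rfl) <;> assumption
  exact htop (Algebra.mem_top : b ∈ _)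

theorem derivation_eq_zero (hφ : Function.Injective M.φ) {D : Derivation k R R}
    (hx : D M.x = 0) (hs : D M.s = 0) : D = 0 := by
  ext b
  refine hφ ?_
  rw [map_derivation, extDer, hx, hs]
  simp

theorem isLead_derivation (D : Derivation k R R) {w : ℤ ×ₗ ℤ} {p q : k}
    (hp : IsLead (mon k 0 (-1) * M.φ (D M.x)) w p) (hq : IsLead (mon k (-1) 0 * M.φ (D M.s)) w q)
    (b : R) (v : ℤ ×ₗ ℤ) (c : k) (h : IsLead (M.φ b) v c) :
    IsLead (M.φ (D b)) (v + w) ((p • xExp k + q • sExp k) v * c) := by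
  have := (hp.mul (h.eulerDer (xExp k))).add (hq.mul (h.eulerDer (sExp k)))
  have hψ : (p • xExp k + q • sExp k) v * c = p * (xExp k v * c) + q * (sExp k v * c) := by
    rw [AddMonoidHom.add_apply, AddMonoidHom.smul_apply, AddMonoidHom.smul_apply, smul_eq_mul,
      smul_eq_mul]
    ring
  rw [map_derivation, extDer, hψ, add_comm v w, Derivation.add_apply, Derivation.smul_apply,
    Derivation.smul_apply, smul_eq_mul, smul_eq_mul]
  exact this

end LaurentModel

section LocallyNilpotent

namespace LaurentModel

variable {k : Type*} [Field k] [CharZero k] {n e d m : ℕ} {f g : ℕ → Polynomial k} {R : Type*}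
  [CommRing R] [Algebra k R] (M : LaurentModel k n e d m f g R)

/-- A nonzero locally nilpotent derivation kills `x` and lowers the degree in `s` by one. -/
theorem derivation_x_eq_zero_and_sDegLE (hn : 1 ≤ n) (hne : ¬(n = 1 ∧ e = 0)) (hd : 2 ≤ d)
    (hm : 2 ≤ m) {D : Derivation k R R} (hD : IsLND D) (hD0 : D ≠ 0) :
    D M.x = 0 ∧ ∀ (j : ℕ) (b : R), ((D.toLinearMap : Module.End k R) ^ (j + 1)) b = 0 →
      M.SDegLE b j := by
  have hφ := M.injective hd hm
  have hne0 : mon k 0 (-1) * M.φ (D M.x) ≠ 0 ∨ mon k (-1) 0 * M.φ (D M.s) ≠ 0 := by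
    by_contra! h
    rw [(isUnit_mon k _ _).mul_right_eq_zero, (isUnit_mon k _ _).mul_right_eq_zero,
      map_eq_zero_iff _ hφ, map_eq_zero_iff _ hφ] at h
    exact hD0 (M.derivation_eq_zero hφ h.1 h.2)
  obtain ⟨w, p, q, hpq, hp, hq⟩ := IsLead.exists_common hne0
  obtain ⟨⟨r, u⟩, rfl⟩ := toLex.surjective w
  have hlead := M.isLead_derivation D hp hq
  set ψ := p • xExp k + q • sExp k with hψdef
  have hψ : ∀ j i : ℤ, ψ (toLex (j, i)) = p * i + q * j := fun j i => rfl
  have hx1 : IsLead (M.φ M.x) (toLex ((0 : ℤ), (1 : ℤ))) 1 := M.map_x ▸ lead_mon k 0 1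
  have hs1 : IsLead (M.φ M.s) (toLex ((1 : ℤ), (0 : ℤ))) 1 := M.map_s ▸ lead_mon k 1 0
  set κ := ψ (toLex (r, u)) with hκdef
  obtain ⟨Nx, hNx⟩ := hD M.x
  obtain ⟨Ns, hNs⟩ := hD M.s
  obtain ⟨P, -, hP⟩ := exists_weight_eq_zero hlead one_ne_zero hx1 hNx
  obtain ⟨Q, -, hQ⟩ := exists_weight_eq_zero hlead one_ne_zero hs1 hNs
  rw [hψ, ← hκdef] at hP hQ
  simp only [Int.cast_one, mul_one, Int.cast_zero, mul_zero, add_zero, zero_add] at hP hQ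
  have hp' : p = -(P * κ) := eq_neg_of_add_eq_zero_left hP
  have hq' : q = -(Q * κ) := eq_neg_of_add_eq_zero_left hQ
  have hκ : κ ≠ 0 := by
    intro h0
    rw [h0, mul_zero, neg_zero] at hp' hq'
    exact hpq.elim (fun h => h hp') fun h => h hq'
  have hψ' : ∀ j i : ℤ, ψ (toLex (j, i)) = -κ * ((P * i + Q * j : ℤ) : k) := by
    intro j i
    rw [hψ, hp', hq']
    push_cast
    ring
  have hPQ : (P : ℤ) * u + Q * r = -1 := by
    have h1 : κ * (((P * u + Q * r + 1 : ℤ)) : k) = 0 := by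
      have := hψ' r u
      rw [← hκdef] at this
      push_cast at this ⊢
      linear_combination this
    have h2 := (mul_eq_zero.1 h1).resolve_left hκ
    have h3 : (P * u + Q * r + 1 : ℤ) = 0 := by exact_mod_cast h2
    linarith
  have hweight : ∀ {b : R} {j i : ℤ} {c : k} {N : ℕ}, c ≠ 0 →
      IsLead (M.φ b) (toLex (j, i)) c → ((D.toLinearMap : Module.End k R) ^ N) b = 0 →
      ∃ t < N, (P : ℤ) * i + Q * j = t := by
    intro b j i c N hc hb hN
    obtain ⟨t, ht, h0⟩ := exists_weight_eq_zero hlead hc hb hN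
    refine ⟨t, ht, ?_⟩
    rw [hψ', ← hκdef] at h0
    have h1 : κ * (((P * i + Q * j - t : ℤ)) : k) = 0 := by
      push_cast at h0 ⊢
      linear_combination -h0
    have h2 := (mul_eq_zero.1 h1).resolve_left hκ
    have h3 : (P * i + Q * j - t : ℤ) = 0 := by exact_mod_cast h2
    linarith
  have hnonneg : ∀ {b : R} {j i : ℤ} {c : k}, c ≠ 0 → IsLead (M.φ b) (toLex (j, i)) c →
      0 ≤ (P : ℤ) * i + Q * j := by
    intro b j i c hc hb
    obtain ⟨N, hN⟩ := hD b
    obtain ⟨t, -, h⟩ := hweight hc hb hN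
    lia
  have hexp : ∀ {b : R} {j i : ℤ} {c : k}, c ≠ 0 → IsLead (M.φ b) (toLex (j, i)) c →
      0 < (P : ℤ) * i + Q * j → IsExponent n e d m (j + r) (i + u) := by
    intro b j i c hc hb hpos
    refine M.isExponent_of_isLead hd hm (b := D b) (c := ψ (toLex (j, i)) * c) ?_ (hlead b _ c hb)
    rw [hψ']
    refine mul_ne_zero (mul_ne_zero (neg_ne_zero.2 hκ) ?_) hc
    exact_mod_cast hpos.ne'
  have hy1 : IsLead (M.φ M.y) (toLex ((d : ℤ), -(n : ℤ))) 1 := M.map_y ▸ lead_yLaurent n d f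
  have hz1 : IsLead (M.φ M.z) (toLex ((m : ℤ) * d, -((e : ℤ) + n * m))) 1 :=
    M.map_z ▸ lead_zLaurent n e hd hm f g
  have hP0 : P = 0 := by
    by_contra hP0
    have hPpos : (0 : ℤ) < P := by exact_mod_cast Nat.pos_of_ne_zero hP0
    have hy2 := hnonneg one_ne_zero hy1
    have hz2 := hnonneg one_ne_zero hz1
    have hx3 := hexp one_ne_zero hx1 (by linarith)
    have hs3 := hexp one_ne_zero hs1
    have hy3 := hexp one_ne_zero hy1
    rw [zero_add, add_comm] at hx3
    refine no_positive_weight hn hne hd hm hPpos hPQ (by linarith) (by linarith) hx3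
      (fun h => ?_) fun h => ?_
    · have := hs3 (by linarith)
      rwa [zero_add, add_comm] at this
    · have := hy3 (by linarith)
      rwa [add_comm, neg_add_eq_sub] at this
  subst hP0
  rw [Nat.cast_zero, zero_mul, zero_add] at hPQ
  have hr : r < 0 := by
    by_contra hr
    have : 0 ≤ (Q : ℤ) * r := mul_nonneg (by positivity) (not_lt.1 hr)
    linarith
  have hQpos : (1 : ℤ) ≤ Q := by
    by_contra hQ0
    have : (Q : ℤ) = 0 := by lia
    rw [this] at hPQ
    lia
  constructor
  · by_contra h0
    obtain ⟨t, c, hc, hl, -⟩ := M.exists_lead hd hm h0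
    have h1 := (lead_mon k 0 (-1)).mul hl
    have h2 := hp.2 _ (by rw [h1.1, one_mul]; exact hc)
    have h3 : (0 : ℤ) ≤ 0 + ((t.2.1 : ℕ) + d * (t.2.2.1 : ℕ) + m * d * t.2.2.2) := by positivity
    rcases Prod.Lex.toLex_le_toLex.1 h2 with h4 | h4
    · exact absurd (h3.trans_lt (h4.trans hr)) (lt_irrefl _)
    · exact absurd (h3.trans_lt (h4.1.trans_lt hr)) (lt_irrefl _)
  · intro j b hb v c hc hv
    obtain ⟨⟨j', i'⟩, rfl⟩ := toLex.surjective v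
    obtain ⟨t, ht, h⟩ := hweight hc hv hb
    have hj' : 0 ≤ j' := (M.isExponent_of_isLead hd hm hc hv).nonneg
    rw [Nat.cast_zero, zero_mul, zero_add] at h
    change j' ≤ j
    nlinarith

/-- The derivation `x^(n+e) ∂/∂s` of `R`. -/
theorem exists_lowering (hd : 2 ≤ d) (hm : 2 ≤ m) :
    ∃ D : Derivation k R R, D ≠ 0 ∧ IsLND D ∧ ∀ (j : ℕ) (b : R), M.SDegLE b j ↔
      ((D.toLinearMap : Module.End k R) ^ (j + 1)) b = 0 := by
  have hφ := M.injective hd hm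
  set δ : Derivation k (AddMonoidAlgebra k (ℤ ×ₗ ℤ)) (AddMonoidAlgebra k (ℤ ×ₗ ℤ)) :=
    mon k (-1) (n + e) • eulerDer (sExp k) with hδ
  have hδapp : ∀ F, δ F = mon k (-1) (n + e) * eulerDer (sExp k) F := fun F => rfl
  have hδx : δ (M.φ M.x) = 0 := by
    rw [hδapp, M.map_x, eulerDer_mon, sExp_toLex, Int.cast_zero, zero_smul, mul_zero]
  have hδs : δ (M.φ M.s) = M.φ (M.x ^ (n + e)) := by
    rw [hδapp, M.map_s, eulerDer_mon, sExp_toLex, Int.cast_one, one_smul, mon_mul, map_pow,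
      M.map_x, mon_pow]
    simp
  have hu : IsUnit (M.φ M.x) := M.map_x ▸ isUnit_mon k 0 1
  have hδpow : ∀ (N : ℕ) (b : R), M.φ (M.x ^ N) * δ (M.φ b) = δ (M.φ (M.x ^ N * b)) := by
    intro N b
    rw [map_mul, Derivation.leibniz, map_pow, Derivation.leibniz_pow, hδx]
    simp
  have hδy : δ (M.φ M.y) = M.φ (M.x ^ e * polyDerivAt d f M.x M.s) := by
    refine (hu.pow n).mul_left_cancel ?_
    rw [← map_pow, hδpow, M.rel_y, map_polyAt, derivation_polyAt δ hδx, hδs, ← map_polyDerivAt,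
      ← map_mul, ← map_mul]
    congr 1
    ring
  have hδz : δ (M.φ M.z) =
      M.φ (polyDerivAt m g M.x M.y * polyDerivAt d f M.x M.s - M.x ^ n) := by
    refine (hu.pow e).mul_left_cancel ?_
    have h : M.x ^ e * M.z = polyAt m g M.x M.y - M.s := by rw [← M.rel_z]; ring
    rw [← map_pow, hδpow, h, map_sub, map_sub, map_polyAt, derivation_polyAt δ hδx, hδs, hδy,
      ← map_polyDerivAt, ← map_mul, ← map_mul, ← map_sub]
    congr 1
    ring
  have hstab : stableSubalgebra M.φ δ = ⊤ := by
    rw [eq_top_iff, ← M.adjoin_eq_top, Algebra.adjoin_le_iff]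
    rintro _ (rfl | rfl | rfl | rfl)
    · exact ⟨0, by rw [hδx]; exact map_zero M.φ⟩
    · exact ⟨_, hδs.symm⟩
    · exact ⟨_, hδy.symm⟩
    · exact ⟨_, hδz.symm⟩
  obtain ⟨D, hD⟩ := exists_derivation_restrict hφ hstab
  have hlead : ∀ b v c, IsLead (M.φ b) v c →
      IsLead (M.φ (D b)) (v + toLex ((-1 : ℤ), (n : ℤ) + e)) (sExp k v * c) := by
    intro b v c h
    have := (lead_mon k (-1) (n + e)).mul (h.eulerDer (sExp k))
    rw [one_mul, add_comm _ v] at this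
    rw [hD, hδapp]
    exact this
  have hlow : ∀ (j : ℤ) (b : R), M.SDegLE b j → M.SDegLE (D b) (j - 1) := by
    intro j b hb v c hc hv
    have hb0 : b ≠ 0 := by
      rintro rfl
      exact hv.ne_zero hc (by rw [map_zero, map_zero])
    obtain ⟨t, c', hc', hl, -⟩ := M.exists_lead hd hm hb0
    have h1 := hb _ _ hc' hl
    have h2 := (hlead b _ _ hl).2 v (by rw [hv.1]; exact hc)
    obtain ⟨⟨j', i'⟩, rfl⟩ := toLex.surjective v
    change j' ≤ j - 1
    change (t.2.1 : ℤ) + d * (t.2.2.1 : ℤ) + m * d * t.2.2.2 ≤ j at h1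
    rcases Prod.Lex.toLex_le_toLex.1 h2 with h4 | h4
    · change j' < (t.2.1 : ℤ) + d * (t.2.2.1 : ℤ) + m * d * t.2.2.2 + -1 at h4
      linarith
    · have h5 : j' = (t.2.1 : ℤ) + d * (t.2.2.1 : ℤ) + m * d * t.2.2.2 + -1 := h4.1
      linarith
  have hkill : ∀ (j : ℕ) (b : R), M.SDegLE b j →
      ((D.toLinearMap : Module.End k R) ^ (j + 1)) b = 0 := by
    have hneg : ∀ b, M.SDegLE b (-1) → b = 0 := by
      intro b hb
      by_contra hb0
      obtain ⟨t, c', hc', hl, -⟩ := M.exists_lead hd hm hb0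
      have h1 := hb _ _ hc' hl
      change (t.2.1 : ℤ) + d * (t.2.2.1 : ℤ) + m * d * t.2.2.2 ≤ -1 at h1
      have : (0 : ℤ) ≤ (t.2.1 : ℤ) + d * (t.2.2.1 : ℤ) + m * d * t.2.2.2 := by positivity
      linarith
    intro j
    induction j with
    | zero => exact fun b hb => hneg _ (by simpa using hlow _ _ hb)
    | succ j ih =>
      intro b hb
      rw [pow_succ, Module.End.mul_apply]
      exact ih _ (by simpa using hlow _ _ hb)
  refine ⟨D, ?_, ?_, fun j b => ⟨hkill j b, fun hb v c hc hv => ?_⟩⟩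
  · rintro rfl
    have h := hD M.s
    rw [hδs, Derivation.zero_apply, map_zero, map_pow] at h
    exact (hu.pow (n + e)).ne_zero h.symm
  · intro b
    obtain ⟨j, hj⟩ := M.exists_sDegLE hd hm b
    exact ⟨j + 1, hkill j b hj⟩
  · obtain ⟨t, ht, h0⟩ := exists_weight_eq_zero hlead hc hv hb
    have h1 : (((ofLex v).1 - t : ℤ) : k) = 0 := by
      have : sExp k (toLex ((-1 : ℤ), (n : ℤ) + e)) = -1 := by
        rw [sExp_toLex, Int.cast_neg, Int.cast_one]
      rw [this] at h0
      push_cast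
      change ((ofLex v).1 : k) + t * -1 = 0 at h0
      linear_combination h0
    have h2 : (ofLex v).1 - t = 0 := by exact_mod_cast h1
    lia

theorem mem_ALi (hd : 2 ≤ d) (hm : 2 ≤ m) {b : R} {j : ℕ} (h : M.SDegLE b j) : b ∈ ALi k R j := by
  obtain ⟨D, hD0, hD, hiff⟩ := M.exists_lowering hd hm
  exact Algebra.subset_adjoin ⟨D, hD, hD0, (hiff j b).1 h⟩

/-- The invariant `AL_j` is generated by the members of degree at most `j` in `s` of the spanning
family. -/
theorem ALi_le (hn : 1 ≤ n) (hne : ¬(n = 1 ∧ e = 0)) (hd : 2 ≤ d) (hm : 2 ≤ m) {j : ℕ}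
    {S : Subalgebra k R}
    (hS : ∀ t : ℕ × Fin d × Fin m × ℕ,
      (t.2.1 : ℕ) + d * (t.2.2.1 : ℕ) + m * d * t.2.2.2 ≤ j → M.fam t ∈ S) :
    ALi k R j ≤ S := by
  refine Algebra.adjoin_le ?_
  rintro b ⟨D, hD, hD0, hb⟩
  exact ((M.derivation_x_eq_zero_and_sDegLE hn hne hd hm hD hD0).2 j b hb).mem hd hm
    fun t ht => hS t (by exact_mod_cast ht)

theorem ALi_zero (hn : 1 ≤ n) (hne : ¬(n = 1 ∧ e = 0)) (hd : 2 ≤ d) (hm : 2 ≤ m) :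
    ALi k R 0 = Algebra.adjoin k {M.x} := by
  refine le_antisymm (M.ALi_le hn hne hd hm ?_) (Algebra.adjoin_le ?_)
  · rintro ⟨i, a, b, c⟩ ht
    exact M.fam_mem_of_eq_zero hd hm (Nat.le_zero.1 ht)
  · rintro _ rfl
    exact M.mem_ALi hd hm M.sDegLE_x

theorem ML_eq (hn : 1 ≤ n) (hne : ¬(n = 1 ∧ e = 0)) (hd : 2 ≤ d) (hm : 2 ≤ m) :
    ML k R = (Algebra.adjoin k {M.x} : Subalgebra k R) := by
  ext b
  constructor
  · intro hb
    obtain ⟨D, -, hD, hiff⟩ := M.exists_lowering hd hm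
    refine ((hiff 0 b).2 (by simpa using hb D hD)).mem hd hm fun t ht => ?_
    exact M.fam_mem_of_eq_zero hd hm (Nat.le_zero.1 (by exact_mod_cast ht))
  · intro hb D hD
    by_cases hD0 : D = 0
    · rw [hD0, Derivation.zero_apply]
    · have hx := (M.derivation_x_eq_zero_and_sDegLE hn hne hd hm hD hD0).1
      have : Set.EqOn D (0 : Derivation k R R) {M.x} := by
        rintro _ rfl
        simpa using hx
      simpa using Derivation.eqOn_adjoin this hb

theorem ALi_of_lt (hn : 1 ≤ n) (hne : ¬(n = 1 ∧ e = 0)) (hd : 2 ≤ d) (hm : 2 ≤ m) {j : ℕ}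
    (hj : 1 ≤ j) (hjd : j < d) : ALi k R j = Algebra.adjoin k {M.x, M.s} := by
  refine le_antisymm (M.ALi_le hn hne hd hm fun t ht => M.fam_mem_of_lt_d hm (ht.trans_lt hjd))
    (Algebra.adjoin_le ?_)
  rintro _ (rfl | rfl)
  · exact M.mem_ALi hd hm (M.sDegLE_x.mono (by lia))
  · exact M.mem_ALi hd hm (M.sDegLE_s.mono (by lia))

theorem ALi_of_lt_mul (hn : 1 ≤ n) (hne : ¬(n = 1 ∧ e = 0)) (hd : 2 ≤ d) (hm : 2 ≤ m) {j : ℕ}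
    (hj : d ≤ j) (hjd : j < m * d) : ALi k R j = Algebra.adjoin k {M.x, M.s, M.y} := by
  refine le_antisymm (M.ALi_le hn hne hd hm fun t ht => M.fam_mem_of_lt_mul (ht.trans_lt hjd))
    (Algebra.adjoin_le ?_)
  rintro _ (rfl | rfl | rfl)
  · exact M.mem_ALi hd hm (M.sDegLE_x.mono (by lia))
  · exact M.mem_ALi hd hm (M.sDegLE_s.mono (by lia))
  · exact M.mem_ALi hd hm (M.sDegLE_y.mono (by lia))

theorem ALi_mul (M : LaurentModel k n e d m f g R) (hd : 2 ≤ d) (hm : 2 ≤ m) :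
    ALi k R (m * d) = ⊤ := by
  rw [eq_top_iff, ← M.adjoin_eq_top, Algebra.adjoin_le_iff]
  have h1 : (1 : ℤ) ≤ ((m * d : ℕ) : ℤ) := by
    exact_mod_cast Nat.mul_pos (by lia) (by lia)
  have h2 : (d : ℤ) ≤ ((m * d : ℕ) : ℤ) := by
    exact_mod_cast Nat.le_mul_of_pos_left d (by lia)
  rintro _ (rfl | rfl | rfl | rfl)
  · exact M.mem_ALi hd hm (M.sDegLE_x.mono (by lia))
  · exact M.mem_ALi hd hm (M.sDegLE_s.mono h1)
  · exact M.mem_ALi hd hm (M.sDegLE_y.mono h2)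
  · exact M.mem_ALi hd hm ((M.sDegLE_z hd hm).mono (by push_cast; rfl))

end LaurentModel

end LocallyNilpotent

section Danielewski

/-- A Danielewski ring `k[x, s, y]` with `xⁿ y = P(x, s)` embeds into the Laurent polynomials. -/
theorem danielewski_injective {k B : Type*} [Field k] [CommRing B] [Algebra k B] {n d : ℕ}
    (hd : 2 ≤ d) {f : ℕ → Polynomial k} {x s y : B}
    {φ : B →ₐ[k] AddMonoidAlgebra k (ℤ ×ₗ ℤ)} (hφx : φ x = mon k 0 1) (hφs : φ s = mon k 1 0)
    (hφy : φ y = yLaurent n d f) (hrel : x ^ n * y = polyAt d f x s)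
    (htop : Algebra.adjoin k {x, s, y} = ⊤) : Function.Injective φ := by
  let w : ℕ × Fin d × ℕ → B := fun t => x ^ t.1 * s ^ (t.2.1 : ℕ) * y ^ t.2.2
  let E : ℕ × Fin d × ℕ → ℤ ×ₗ ℤ := fun t =>
    toLex (t.1 * 0 + (t.2.1 : ℕ) + t.2.2 * (d : ℤ), t.1 + (t.2.1 : ℕ) * 0 + t.2.2 * -(n : ℤ))
  have hE : Function.Injective E := by
    rintro ⟨i, a, b⟩ ⟨i', a', b'⟩ h
    have h1 : (i : ℤ) * 0 + (a : ℕ) + b * (d : ℤ) = i' * 0 + (a' : ℕ) + b' * d :=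
      congrArg (fun v => (ofLex v).1) h
    have h2 : (i : ℤ) + (a : ℕ) * 0 + b * -(n : ℤ) = i' + (a' : ℕ) * 0 + b' * -n :=
      congrArg (fun v => (ofLex v).2) h
    obtain ⟨ha, -, rfl⟩ := eq_of_mixed_radix (m := 1) (b := 0) (b' := 0) (c := b) (c' := b')
      a.2 a'.2 one_pos one_pos (by zify; linarith)
    rw [Fin.ext ha, show i = i' by zify; linarith]
  have hw : ∀ t, IsLead (φ (w t)) (E t) 1 := by
    intro t
    have h := (((lead_mon k 0 1).pow t.1).mul ((lead_mon k 1 0).pow t.2.1)).mul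
      ((lead_yLaurent n d f).pow t.2.2)
    simp only [nsmul_toLex, ← toLex_add, Prod.mk_add_mk, one_pow, mul_one] at h
    simpa only [w, E, map_mul, map_pow, hφx, hφs, hφy] using h
  refine injective_of_span_eq_top hE hw ?_
  set W := Submodule.span k (Set.range w) with hW
  have hx : ∀ v ∈ W, x * v ∈ W := by
    intro v hv
    induction hv using Submodule.span_induction with
    | mem v hv =>
      obtain ⟨⟨i, a, b⟩, rfl⟩ := hv
      refine Submodule.subset_span ⟨(i + 1, a, b), ?_⟩
      simp only [w]
      ring
    | zero => simp
    | add v w _ _ hv hw => simpa [mul_add] using W.add_mem hv hw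
    | smul r v _ hv => simpa using W.smul_mem r hv
  have hmono : ∀ N i a b : ℕ, a + b = N → x ^ i * s ^ a * y ^ b ∈ W := by
    intro N
    induction N using Nat.strong_induction_on with
    | _ N ih =>
    rintro i a b rfl
    by_cases ha : a < d
    · exact Submodule.subset_span ⟨(i, ⟨a, ha⟩, b), rfl⟩
    · obtain ⟨a, rfl⟩ := Nat.exists_eq_add_of_le' (not_lt.1 ha)
      have := mul_pow_mem_of_polyAt hx hrel (v := x ^ i * s ^ a * y ^ b) ?_ ?_
      · convert this using 1
        ring
      · convert ih _ (by lia) (i + n) a (b + 1) rfl using 1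
        ring
      · intro j hj
        convert ih _ (by lia) i (a + j) b rfl using 1
        ring
  refine submodule_eq_top_of_mul_mem htop ?_ ?_
  · simpa using hmono _ 0 0 0 rfl
  · intro t ht v hv
    induction hv using Submodule.span_induction with
    | mem v hv =>
      obtain ⟨⟨i, a, b⟩, rfl⟩ := hv
      simp only [Set.mem_insert_iff, Set.mem_singleton_iff] at ht
      rcases ht with rfl | rfl | rfl
      · convert hmono _ (i + 1) a b rfl using 1
        simp only [w]
        ring
      · convert hmono _ i (a + 1) b rfl using 1
        simp only [w]
        ring
      · convert hmono _ i a (b + 1) rfl using 1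
        simp only [w]
        ring
    | zero => simp
    | add v w _ _ hv hw => simpa [mul_add] using W.add_mem hv hw
    | smul r v _ hv => simpa using W.smul_mem r hv

end Danielewski

section Presentation

theorem adjoin_mk_X_eq_top {k : Type*} [CommRing k] (I : Ideal (MvPolynomial (Fin 3) k)) :
    Algebra.adjoin k {Ideal.Quotient.mk I (X 0), Ideal.Quotient.mk I (X 1),
      Ideal.Quotient.mk I (X 2)} = ⊤ := by
  have h := congrArg (Subalgebra.map (Ideal.Quotient.mkₐ k I))
    (MvPolynomial.adjoin_range_X (R := k) (σ := Fin 3))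
  rw [AlgHom.map_adjoin, ← Set.range_comp, Algebra.map_top,
    (AlgHom.range_eq_top _).2 (Ideal.Quotient.mkₐ_surjective k I)] at h
  rw [← h]
  congr 1
  ext b
  simp [Fin.exists_fin_succ, eq_comm]

variable {k : Type*} [Field k] (n e d m : ℕ) (f g : ℕ → Polynomial k)

theorem relation_yel :
    xel k n e d m f g ^ n * yel k n e d m f g = polyAt d f (xel k n e d m f g)
      (sel k n e d m f g) := by
  have h : Ideal.Quotient.mkₐ k (RIdeal k n e d m f g) (X 0 ^ n * X 1) =
      Ideal.Quotient.mkₐ k (RIdeal k n e d m f g) (Pat k d f (Qpoly k m g - X 0 ^ e * X 2)) :=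
    Ideal.Quotient.eq.2 (Ideal.subset_span rfl)
  rw [map_mul, map_pow] at h
  exact h.trans (map_polyAt _ d f (X 0) _)

theorem relation_zel :
    sel k n e d m f g + xel k n e d m f g ^ e * zel k n e d m f g =
      polyAt m g (xel k n e d m f g) (yel k n e d m f g) := by
  have h : Ideal.Quotient.mkₐ k (RIdeal k n e d m f g)
      ((Qpoly k m g - X 0 ^ e * X 2) + X 0 ^ e * X 2) =
      Ideal.Quotient.mkₐ k (RIdeal k n e d m f g) (Qpoly k m g) := by
    rw [sub_add_cancel]
  rw [map_add, map_mul, map_pow] at h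
  exact h.trans (map_polyAt _ m g (X 0) (X 1))

/-- The evaluation of polynomials at the images of `x`, `y`, `z` in the Laurent polynomials. -/
noncomputable def evalLaurent : MvPolynomial (Fin 3) k →ₐ[k] AddMonoidAlgebra k (ℤ ×ₗ ℤ) :=
  aeval ![mon k 0 1, yLaurent n d f, zLaurent n e d m f g]

theorem evalLaurent_s :
    evalLaurent n e d m f g (Qpoly k m g - X 0 ^ e * X 2) = mon k 1 0 := by
  have hQ : evalLaurent n e d m f g (Qpoly k m g) =
      polyAt m g (mon k 0 1) (yLaurent n d f) := by
    refine (map_polyAt _ m g (X 0) (X 1)).trans ?_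
    simp [evalLaurent]
  have hX : evalLaurent n e d m f g (X 0 ^ e * X 2) =
      polyAt m g (mon k 0 1) (yLaurent n d f) - mon k 1 0 := by
    rw [← mon_mul_zLaurent n e d m f g]
    simp [evalLaurent]
  rw [map_sub, hQ, hX, sub_sub_cancel]

/-- The map from `R_{n,e,P,Q}` to the Laurent polynomials. -/
noncomputable def toLaurent : RRing k n e d m f g →ₐ[k] AddMonoidAlgebra k (ℤ ×ₗ ℤ) :=
  Ideal.Quotient.liftₐ (RIdeal k n e d m f g) (evalLaurent n e d m f g) fun a ha => by
    have hle : RIdeal k n e d m f g ≤ RingHom.ker (evalLaurent n e d m f g) := by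
      rw [RIdeal, Ideal.span_singleton_le_iff_mem, RingHom.mem_ker, map_sub, sub_eq_zero]
      refine Eq.trans ?_ (map_polyAt (evalLaurent n e d m f g) d f (X 0) _).symm
      rw [evalLaurent_s]
      have h0 : evalLaurent n e d m f g (X 0) = mon k 0 1 := by simp [evalLaurent]
      have h1 : evalLaurent n e d m f g (X 1) = yLaurent n d f := by simp [evalLaurent]
      rw [map_mul, map_pow, h0, h1, mon_mul_yLaurent]
    exact hle ha

/-- The Laurent model of `R_{n,e,P,Q}`. -/
noncomputable def rModel : LaurentModel k n e d m f g (RRing k n e d m f g) where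
  x := xel k n e d m f g
  s := sel k n e d m f g
  y := yel k n e d m f g
  z := zel k n e d m f g
  φ := toLaurent n e d m f g
  map_x := (aeval_X _ _).trans rfl
  map_s := evalLaurent_s n e d m f g
  map_y := (aeval_X _ _).trans rfl
  map_z := (aeval_X _ _).trans rfl
  rel_y := relation_yel n e d m f g
  rel_z := relation_zel n e d m f g
  adjoin_eq_top := by
    rw [eq_top_iff]
    refine (adjoin_mk_X_eq_top (RIdeal k n e d m f g)).ge.trans (Algebra.adjoin_mono ?_)
    rintro _ (rfl | rfl | rfl)
    · exact Or.inl rfl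
    · exact Or.inr (Or.inr (Or.inl rfl))
    · exact Or.inr (Or.inr (Or.inr rfl))

/-- The classes of `X`, `S`, `Y` in the Danielewski ring. -/
noncomputable def danGen (i : Fin 3) : DanRing k n d f :=
  Ideal.Quotient.mk (DanIdeal k n d f) (X i)

theorem adjoin_danGen : Algebra.adjoin k {danGen n d f 0, danGen n d f 1, danGen n d f 2} = ⊤ :=
  adjoin_mk_X_eq_top (DanIdeal k n d f)

theorem relation_danGen :
    danGen n d f 0 ^ n * danGen n d f 2 = polyAt d f (danGen n d f 0) (danGen n d f 1) := by
  have h : Ideal.Quotient.mkₐ k (DanIdeal k n d f) (X 0 ^ n * X 2) =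
      Ideal.Quotient.mkₐ k (DanIdeal k n d f) (Pat k d f (X 1)) :=
    Ideal.Quotient.eq.2 (Ideal.subset_span rfl)
  rw [map_mul, map_pow] at h
  exact h.trans (map_polyAt _ d f (X 0) _)

/-- The map from the Danielewski ring to `R_{n,e,P,Q}` with image `k[x, s, y]`. -/
noncomputable def danToR : DanRing k n d f →ₐ[k] RRing k n e d m f g :=
  Ideal.Quotient.liftₐ (DanIdeal k n d f)
    (aeval ![xel k n e d m f g, sel k n e d m f g, yel k n e d m f g]) fun a ha => by
    have hle : DanIdeal k n d f ≤ RingHom.ker (aeval (R := k)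
        ![xel k n e d m f g, sel k n e d m f g, yel k n e d m f g]) := by
      rw [DanIdeal, Ideal.span_singleton_le_iff_mem, RingHom.mem_ker, map_sub, sub_eq_zero]
      refine Eq.trans ?_ (map_polyAt _ d f (X 0) (X 1)).symm
      rw [map_mul, map_pow, aeval_X, aeval_X, aeval_X]
      exact relation_yel n e d m f g
    exact hle ha

theorem danToR_danGen (i : Fin 3) : danToR n e d m f g (danGen n d f i) =
    ![xel k n e d m f g, sel k n e d m f g, yel k n e d m f g] i :=
  aeval_X _ i

theorem danToR_injective (hd : 2 ≤ d) : Function.Injective (danToR n e d m f g) := by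
  have h : Function.Injective ((toLaurent n e d m f g).comp (danToR n e d m f g)) := by
    refine danielewski_injective hd ?_ ?_ ?_ (relation_danGen n d f) (adjoin_danGen n d f)
    · exact (congrArg _ (danToR_danGen n e d m f g 0)).trans (rModel n e d m f g).map_x
    · exact (congrArg _ (danToR_danGen n e d m f g 1)).trans (rModel n e d m f g).map_s
    · exact (congrArg _ (danToR_danGen n e d m f g 2)).trans (rModel n e d m f g).map_y
  exact Function.Injective.of_comp h

theorem range_danToR :
    (danToR n e d m f g).range =
      Algebra.adjoin k {xel k n e d m f g, sel k n e d m f g, yel k n e d m f g} := by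
  rw [← Algebra.map_top, ← adjoin_danGen, AlgHom.map_adjoin, Set.image_insert_eq,
    Set.image_insert_eq, Set.image_singleton, danToR_danGen, danToR_danGen, danToR_danGen]
  rfl

end Presentation

theorem stmt12 {k : Type*} [Field k] [CharZero k]
    (n e d m : ℕ) (hn : 1 ≤ n) (hne : ¬(n = 1 ∧ e = 0)) (hd : 2 ≤ d) (hm : 2 ≤ m)
    (f g : ℕ → Polynomial k) :
    -- (1) `AL_0(R) = k[x] = ML(R)`
    ALi k (RRing k n e d m f g) 0 = Algebra.adjoin k {xel k n e d m f g} ∧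
    ML k (RRing k n e d m f g) =
      ((Algebra.adjoin k {xel k n e d m f g} : Subalgebra k (RRing k n e d m f g)) :
        Set (RRing k n e d m f g)) ∧
    -- (2) `AL_i(R) = k[x,s]` for `1 ≤ i ≤ d-1`
    (∀ i : ℕ, 1 ≤ i → i ≤ d - 1 →
      ALi k (RRing k n e d m f g) i =
        Algebra.adjoin k {xel k n e d m f g, sel k n e d m f g}) ∧
    -- (3) `AL_i(R) = k[x,s,y]` for `d ≤ i ≤ md-1`, and `k[x,s,y] ≅ B_{n,P}`
    (∀ i : ℕ, d ≤ i → i ≤ m * d - 1 →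
      ALi k (RRing k n e d m f g) i =
        Algebra.adjoin k {xel k n e d m f g, sel k n e d m f g, yel k n e d m f g}) ∧
    Nonempty ((Algebra.adjoin k
        {xel k n e d m f g, sel k n e d m f g, yel k n e d m f g}) ≃ₐ[k] DanRing k n d f) ∧
    -- (4) `AL_{md}(R) = R`
    ALi k (RRing k n e d m f g) (m * d) = ⊤ := by
  refine ⟨(rModel n e d m f g).ALi_zero hn hne hd hm, (rModel n e d m f g).ML_eq hn hne hd hm,
    fun i hi hid => (rModel n e d m f g).ALi_of_lt hn hne hd hm hi (by lia),
    fun i hi him => (rModel n e d m f g).ALi_of_lt_mul hn hne hd hm hi (by lia), ⟨?_⟩,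
    (rModel n e d m f g).ALi_mul hd hm⟩
  exact ((AlgEquiv.ofInjective _ (danToR_injective n e d m f g hd)).trans
    (Subalgebra.equivOfEq _ _ (range_danToR n e d m f g))).symm
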